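/- arXiv:2511.18518 — 2 statements merged into one kernel-verified Lean document; each statement's English description precedes it below -/
import Mathlib

section
/- Let C be an abelian category, let A ⊆ C be a Serre subcategory, and let B ⊆ C be a full abelian subcategory containing A whose inclusion into C is exact. Assume that for every object X of C, every object Y of A, and every epimorphism X → Y in C, there exists a subobject X' ⊆ X belonging to A such that the composition X' → X → Y is an epimorphism. Then for every M₁ in D⁻(A) and M₂ in D⁻(B), the natural map Hom_{D⁻(B)}(M₁, M₂) → Hom_{D⁻(C)}(M₁, M₂) is a bijection. -/
open CategoryTheory CategoryTheory.Limits

namespace Stmt4Aux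

variable {A C : Type*} [Category A] [Category C] [Abelian A] [Abelian C]

/-- Degreewise data for the subcomplex with terms in `A`. -/
structure Dat (F : A ⥤ C) (L : CochainComplex C ℤ) (n i : ℤ) where
  Y : A
  g : F.obj Y ⟶ L.X i
  mono : Mono g
  hc : ∀ (W : C) (x : W ⟶ L.X i), x ≫ L.d i (i + 1) = 0 →
    ∃ (W' : C) (π : W' ⟶ W) (_ : Epi π) (y : W' ⟶ F.obj Y) (w : W' ⟶ L.X (i - 1)),
      π ≫ x = y ≫ g + w ≫ L.d (i - 1) i
  hz : n < i → IsZero Y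

/-- Compatibility of the data in consecutive degrees. -/
def Rel {F : A ⥤ C} {L : CochainComplex C ℤ} {n i j : ℤ} (D' : Dat F L n i) (D : Dat F L n j) :
    Prop :=
  ∃ δ : F.obj D'.Y ⟶ F.obj D.Y, δ ≫ D.g = D'.g ≫ L.d i j ∧
    ∀ (W : C) (y : W ⟶ F.obj D.Y) (x : W ⟶ L.X i), y ≫ D.g = x ≫ L.d i j →
      ∃ (W' : C) (π : W' ⟶ W) (_ : Epi π) (z : W' ⟶ F.obj D'.Y), π ≫ y = z ≫ δ

section

set_option linter.unusedSectionVars false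

variable (F : A ⥤ C) [F.Full] [F.Faithful] [F.Additive] (L : CochainComplex C ℤ) (n : ℤ)

lemma rel_of_isZero {i j : ℤ} (D' : Dat F L n i) (D : Dat F L n j) (h' : IsZero D'.Y)
    (h : IsZero D.Y) : Rel D' D := by
  refine ⟨0, (F.map_isZero h').eq_of_src _ _, fun W y x _ => ⟨W, 𝟙 _, inferInstance, 0, ?_⟩⟩
  exact (F.map_isZero h).eq_of_tgt _ _

lemma exists_zero (hL : ∀ i, n < i → IsZero (L.homology i)) (i : ℤ) (hi : n < i) :
    Nonempty (Dat F L n i) := by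
  obtain ⟨O, hO⟩ := HasZeroObject.zero (C := A)
  have h0 : IsZero (F.obj O) := F.map_isZero hO
  refine ⟨⟨O, 0, ⟨fun _ _ _ => h0.eq_of_tgt _ _⟩, fun W x hx => ?_, fun _ => hO⟩⟩
  have he : L.ExactAt i := (L.exactAt_iff_isZero_homology i).2 (hL i hi)
  rw [L.exactAt_iff_exact_up_to_refinements (i - 1) i (i + 1) (by simp) (by simp)] at he
  obtain ⟨W', π, hπ, w, hw⟩ := he x hx
  exact ⟨W', π, hπ, 0, w, by simp [hw]⟩

lemma step
    (hsub : ∀ (X : C) (Z : A) (f : X ⟶ F.obj Z), Mono f → ∃ Y : A, Nonempty (X ≅ F.obj Y))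
    (hquot : ∀ (X : A) (Z : C) (f : F.obj X ⟶ Z), Epi f → ∃ Y : A, Nonempty (Z ≅ F.obj Y))
    (hlift : ∀ (X : C) (Y : A) (f : X ⟶ F.obj Y), Epi f →
      ∃ (Y' : A) (g : F.obj Y' ⟶ X), Mono g ∧ Epi (g ≫ f))
    (hH : ∀ i, ∃ Y : A, Nonempty (L.homology i ≅ F.obj Y))
    (hL : ∀ i, n < i → IsZero (L.homology i)) (m i : ℤ) (hmi : m + 1 = i) (D : Dat F L n i) :
    ∃ D' : Dat F L n m, Rel D' D := by
  by_cases hm : n < m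
  · obtain ⟨D'⟩ := exists_zero F L n hL m hm
    exact ⟨D', rel_of_isZero F L n D' D (D'.hz hm) (D.hz (by lia))⟩
  have := D.mono
  subst hmi
  let p1 := pullback.fst (L.d m (m + 1)) D.g
  let p2 := pullback.snd (L.d m (m + 1)) D.g
  have hp : p1 ≫ L.d m (m + 1) = p2 ≫ D.g := pullback.condition
  obtain ⟨YI, ⟨eI⟩⟩ := hsub _ _ (image.ι p2) inferInstance
  obtain ⟨Y1, h, -, hepi1⟩ := hlift _ YI (factorThruImage p2 ≫ eI.hom) inferInstance
  obtain ⟨YH, ⟨eH⟩⟩ := hH m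
  obtain ⟨Y2, k, -, hepi2⟩ := hlift _ YH (L.homologyπ m ≫ eH.hom) inferInstance
  let φ : F.obj (Y1 ⊞ Y2) ⟶ L.X m :=
    F.map biprod.fst ≫ h ≫ p1 + F.map biprod.snd ≫ k ≫ L.iCycles m
  have hφ1 : F.map biprod.inl ≫ φ = h ≫ p1 := by
    simp only [φ, Preadditive.comp_add, ← Functor.map_comp_assoc]
    simp
  have hφ2 : F.map biprod.inr ≫ φ = k ≫ L.iCycles m := by
    simp only [φ, Preadditive.comp_add, ← Functor.map_comp_assoc]
    simp
  have hφd : φ ≫ L.d m (m + 1) = (F.map biprod.fst ≫ h ≫ p2) ≫ D.g := by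
    simp [φ, hp]
  obtain ⟨Y', ⟨e⟩⟩ := hquot _ _ (factorThruImage φ) inferInstance
  let g' : F.obj Y' ⟶ L.X m := e.inv ≫ image.ι φ
  let q : F.obj (Y1 ⊞ Y2) ⟶ F.obj Y' := factorThruImage φ ≫ e.hom
  have hq : q ≫ g' = φ := by simp [q, g']
  have hqe : Epi q := inferInstance
  have sq : CommSq (F.map biprod.fst ≫ h ≫ p2) q D.g (g' ≫ L.d m (m + 1)) :=
    ⟨by rw [← hφd, ← hq, Category.assoc]⟩
  have : StrongEpi q := strongEpi_of_epi q
  have hδ := sq.fac_right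
  refine ⟨⟨Y', g', inferInstance, fun W x hx => ?_, fun h => absurd h hm⟩, sq.lift, hδ, ?_⟩
  · obtain ⟨W₁, π₁, hπ₁, y, hy⟩ := surjective_up_to_refinements_of_epi (k ≫ L.homologyπ m ≫ eH.hom)
      (L.liftCycles x (m + 1) (by simp) hx ≫ L.homologyπ m ≫ eH.hom)
    have h1 : (π₁ ≫ L.liftCycles x (m + 1) (by simp) hx) ≫ L.homologyπ m =
        (y ≫ k) ≫ L.homologyπ m := by
      simpa [← Category.assoc] using hy
    rw [L.comp_homologyπ_eq_iff_up_to_refinements (m - 1) m (by simp)] at h1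
    obtain ⟨W₂, π₂, hπ₂, w, hw⟩ := h1
    refine ⟨W₂, π₂ ≫ π₁, inferInstance, π₂ ≫ y ≫ F.map biprod.inr ≫ q, w, ?_⟩
    have := congr($hw ≫ L.iCycles m)
    simp only [Category.assoc, HomologicalComplex.liftCycles_i, Preadditive.add_comp,
      HomologicalComplex.toCycles_i] at this
    simp only [Category.assoc, hq, hφ2, this]
  · intro W y x hyx
    dsimp at x hyx ⊢
    obtain ⟨W₁, π₁, hπ₁, z, hz⟩ := surjective_up_to_refinements_of_epi
      (h ≫ factorThruImage p2 ≫ eI.hom)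
      (pullback.lift x y hyx.symm ≫ factorThruImage p2 ≫ eI.hom)
    have h1 : π₁ ≫ y = z ≫ h ≫ p2 := by
      have := congr($hz ≫ eI.inv ≫ image.ι p2)
      simp only [Category.assoc, Iso.hom_inv_id_assoc, image.fac] at this
      rwa [show pullback.lift x y hyx.symm ≫ p2 = y from pullback.lift_snd _ _ _] at this
    refine ⟨W₁, π₁, hπ₁, z ≫ F.map biprod.inl ≫ q, ?_⟩
    rw [← cancel_mono D.g]
    simp only [Category.assoc, hδ]
    rw [reassoc_of% hq, reassoc_of% hφ1, hp, reassoc_of% h1]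

lemma exists_family
    (hsub : ∀ (X : C) (Z : A) (f : X ⟶ F.obj Z), Mono f → ∃ Y : A, Nonempty (X ≅ F.obj Y))
    (hquot : ∀ (X : A) (Z : C) (f : F.obj X ⟶ Z), Epi f → ∃ Y : A, Nonempty (Z ≅ F.obj Y))
    (hlift : ∀ (X : C) (Y : A) (f : X ⟶ F.obj Y), Epi f →
      ∃ (Y' : A) (g : F.obj Y' ⟶ X), Mono g ∧ Epi (g ≫ f))
    (hH : ∀ i, ∃ Y : A, Nonempty (L.homology i ≅ F.obj Y))
    (hL : ∀ i, n < i → IsZero (L.homology i)) :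
    ∃ S : ∀ i, Dat F L n i, ∀ i j, i + 1 = j → Rel (S i) (S j) := by
  have z : ∀ i, n < i → Dat F L n i := fun i hi => (exists_zero F L n hL i hi).some
  choose st hst using step F L n hsub hquot hlift hH hL
  let S : ∀ i, Dat F L n i := fun i => Int.inductionOn' (motive := fun i => Dat F L n i) i (n + 1)
    (z _ (by lia)) (fun k hk _ => (z _ (by lia))) (fun k hk D => st (k - 1) k (by lia) D)
  refine ⟨S, ?_⟩
  rintro i j hij
  by_cases h : n < i
  · exact rel_of_isZero F L n _ _ ((S i).hz h) ((S j).hz (by lia))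
  · obtain rfl : i = j - 1 := by lia
    have : S (j - 1) = st (j - 1) j (by lia) (S j) := Int.inductionOn'_sub_one (by lia)
    rw [this]
    apply hst

lemma key
    (hsub : ∀ (X : C) (Z : A) (f : X ⟶ F.obj Z), Mono f → ∃ Y : A, Nonempty (X ≅ F.obj Y))
    (hquot : ∀ (X : A) (Z : C) (f : F.obj X ⟶ Z), Epi f → ∃ Y : A, Nonempty (Z ≅ F.obj Y))
    (hlift : ∀ (X : C) (Y : A) (f : X ⟶ F.obj Y), Epi f →
      ∃ (Y' : A) (g : F.obj Y' ⟶ X), Mono g ∧ Epi (g ≫ f))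
    (hH : ∀ i, ∃ Y : A, Nonempty (L.homology i ≅ F.obj Y))
    (hL : ∀ i, n < i → IsZero (L.homology i)) :
    ∃ (K : CochainComplex A ℤ) (t : (F.mapHomologicalComplex (ComplexShape.up ℤ)).obj K ⟶ L),
      QuasiIso t := by
  obtain ⟨S, hS⟩ := exists_family F L n hsub hquot hlift hH hL
  have (i : ℤ) := (S i).mono
  have hd : ∀ i j, ∃ δ : (S i).Y ⟶ (S j).Y, F.map δ ≫ (S j).g = (S i).g ≫ L.d i j := by
    intro i j
    by_cases hij : i + 1 = j
    · obtain ⟨δ, hδ, -⟩ := hS i j hij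
      exact ⟨F.preimage δ, by simpa using hδ⟩
    · exact ⟨0, by rw [L.shape _ _ hij]; simp⟩
  choose δ hδ using hd
  let K : CochainComplex A ℤ :=
    { X i := (S i).Y
      d i j := δ i j
      shape i j hij := by
        apply F.map_injective
        rw [← cancel_mono (S j).g, hδ, L.shape _ _ hij]
        simp
      d_comp_d' i j k _ _ := by
        apply F.map_injective
        rw [← cancel_mono (S k).g, F.map_comp, Category.assoc, hδ, reassoc_of% (hδ i j)]
        simp }
  let t : (F.mapHomologicalComplex (ComplexShape.up ℤ)).obj K ⟶ L :=
    { f i := (S i).g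
      comm' i j _ := (hδ i j).symm }
  refine ⟨K, t, ⟨fun i => ?_⟩⟩
  rw [quasiIsoAt_iff_isIso_homologyMap]
  have h1 : Mono (HomologicalComplex.homologyMap t i) := by
    rw [HomologicalComplex.mono_homologyMap_iff_up_to_refinements t (i - 1) i (i + 1)
      (by simp) (by simp)]
    intro W x hx y hxy
    obtain ⟨δ', hδ', hb⟩ := hS (i - 1) i (by lia)
    obtain ⟨W', π, hπ, z, hz⟩ := hb W x y hxy
    refine ⟨W', π, hπ, z, ?_⟩
    have : δ' = F.map (δ (i - 1) i) := by
      rw [← cancel_mono (S i).g, hδ, hδ']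
    subst this
    exact hz
  have h2 : Epi (HomologicalComplex.homologyMap t i) := by
    rw [HomologicalComplex.epi_homologyMap_iff_up_to_refinements t (i - 1) i (i + 1)
      (by simp) (by simp)]
    intro W x hx
    obtain ⟨W', π, hπ, y, w, h⟩ := (S i).hc W x hx
    refine ⟨W', π, hπ, y, ?_, w, h⟩
    change y ≫ F.map (δ i (i + 1)) = 0
    rw [← cancel_mono (S (i + 1)).g, Category.assoc, hδ]
    have := congr($h ≫ L.d i (i + 1))
    simpa [hx] using this.symm
  exact isIso_of_mono_of_epi _

end

end Stmt4Aux

namespace Stmt4Aux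

/-- Resolution by complexes with terms in `A`. -/
lemma res {A C : Type*} [Category A] [Category C] [Abelian A] [Abelian C]
    (F : A ⥤ C) [F.Full] [F.Faithful] [F.Additive]
    [PreservesFiniteLimits F] [PreservesFiniteColimits F]
    (hsub : ∀ (X : C) (Z : A) (f : X ⟶ F.obj Z), Mono f → ∃ Y : A, Nonempty (X ≅ F.obj Y))
    (hquot : ∀ (X : A) (Z : C) (f : F.obj X ⟶ Z), Epi f → ∃ Y : A, Nonempty (Z ≅ F.obj Y))
    (hlift : ∀ (X : C) (Y : A) (f : X ⟶ F.obj Y), Epi f →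
      ∃ (Y' : A) (g : F.obj Y' ⟶ X), Mono g ∧ Epi (g ≫ f))
    (K : CochainComplex A ℤ) (hK : ∃ n : ℤ, ∀ i, n < i → IsZero (K.X i))
    (L : CochainComplex C ℤ) (s : L ⟶ (F.mapHomologicalComplex (ComplexShape.up ℤ)).obj K)
    (hs : QuasiIso s) :
    ∃ (K' : CochainComplex A ℤ) (t : (F.mapHomologicalComplex (ComplexShape.up ℤ)).obj K' ⟶ L),
      QuasiIso t := by
  obtain ⟨n, hn⟩ := hK
  have e : ∀ i, L.homology i ≅ F.obj (K.homology i) := fun i =>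
    asIso (HomologicalComplex.homologyMap s i) ≪≫ (K.sc i).mapHomologyIso F
  refine key F L n hsub hquot hlift (fun i => ⟨_, ⟨e i⟩⟩) (fun i hi => ?_)
  refine IsZero.of_iso (F.map_isZero ?_) (e i)
  exact (HomologicalComplex.exactAt_iff_isZero_homology K i).1
    (ShortComplex.exact_of_isZero_X₂ _ (hn i hi))

lemma exists_preimage {B C : Type*} [Category B] [Category C] [Abelian B] [Abelian C]
    (G : B ⥤ C) [G.Full] [G.Faithful] [G.Additive] {K L : CochainComplex B ℤ}
    (f : (G.mapHomologicalComplex (ComplexShape.up ℤ)).obj K ⟶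
      (G.mapHomologicalComplex (ComplexShape.up ℤ)).obj L) :
    ∃ g : K ⟶ L, (G.mapHomologicalComplex (ComplexShape.up ℤ)).map g = f := by
  choose φ hφ using fun i => G.map_surjective (X := K.X i) (Y := L.X i) (f.f i)
  refine ⟨{ f i := φ i, comm' i j _ := G.map_injective ?_ }, ?_⟩
  · rw [G.map_comp, G.map_comp, hφ, hφ]
    exact f.comm i j
  · ext i
    exact hφ i

lemma Q_map_eq_zero {C : Type*} [Category C] [Abelian C] [HasDerivedCategory C]
    {K L : CochainComplex C ℤ} (f : K ⟶ L) (hf : DerivedCategory.Q.map f = 0) :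
    ∃ (K' : CochainComplex C ℤ) (s : K' ⟶ K), QuasiIso s ∧ Nonempty (Homotopy (s ≫ f) 0) := by
  have h : DerivedCategory.Qh.map ((HomotopyCategory.quotient _ _).map f) =
      DerivedCategory.Qh.map ((HomotopyCategory.quotient _ _).map 0) := by
    rw [← cancel_mono ((DerivedCategory.quotientCompQhIso C).hom.app L),
      DerivedCategory.quotientCompQhIso_hom_naturality, hf]
    simp
  rw [MorphismProperty.map_eq_iff_precomp DerivedCategory.Qh
    (HomotopyCategory.quasiIso C (ComplexShape.up ℤ))] at h
  obtain ⟨X, s, hs, h⟩ := h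
  obtain ⟨X, rfl⟩ := HomotopyCategory.quotient_obj_surjective X
  obtain ⟨s, rfl⟩ := (HomotopyCategory.quotient _ _).map_surjective s
  rw [HomotopyCategory.quotient_map_mem_quasiIso_iff] at hs
  refine ⟨X, s, hs, (HomotopyCategory.quotient_map_eq_zero_iff _).1 ?_⟩
  rw [Functor.map_comp, h]
  simp

lemma Q_map_eq_zero_of_homotopy {C : Type*} [Category C] [Abelian C] [HasDerivedCategory C]
    {K L : CochainComplex C ℤ} (f : K ⟶ L) (h : Homotopy f 0) :
    DerivedCategory.Q.map f = 0 := by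
  have h' := HomotopyCategory.eq_of_homotopy _ _ h
  rw [← cancel_epi ((DerivedCategory.quotientCompQhIso C).hom.app K),
      ← DerivedCategory.quotientCompQhIso_hom_naturality, h']
  simp

lemma Q_map_map_eq {B C : Type*} [Category B] [Category C] [Abelian B] [Abelian C]
    (G : B ⥤ C) [G.Additive] [PreservesFiniteLimits G] [PreservesFiniteColimits G]
    [HasDerivedCategory B] [HasDerivedCategory C]
    {K L : CochainComplex B ℤ} (f : K ⟶ L) :
    G.mapDerivedCategory.map (DerivedCategory.Q.map f) =
      G.mapDerivedCategoryFactors.hom.app K ≫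
        DerivedCategory.Q.map ((G.mapHomologicalComplex (ComplexShape.up ℤ)).map f) ≫
        G.mapDerivedCategoryFactors.inv.app L := by
  rw [← Functor.mapDerivedCategoryFactors_hom_naturality_assoc]
  simp

end Stmt4Aux

/-- Let `C` be an abelian category, `A ⊆ C` a Serre subcategory and `B ⊆ C` a
full abelian subcategory containing `A` whose inclusion into `C` is exact. (Here the
subcategories are encoded by fully faithful exact functors `ι₁ : A ⥤ B` and `ι₂ : B ⥤ C`; the
Serre condition on the essential image of `ι₁ ⋙ ι₂` is encoded by closure under subobjects,
quotients and extensions.) Assume that for every object `X` of `C`, every object `Y` of `A` and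
every epimorphism `X → Y` in `C`, there is a subobject `X' ⊆ X` belonging to `A` such that the
composition `X' → X → Y` is an epimorphism. Then for every `M₁` in `D⁻(A)` and `M₂` in `D⁻(B)`
(represented by bounded above cochain complexes `K₁` over `A` and `K₂` over `B`), the natural map
`Hom_{D⁻(B)}(M₁, M₂) → Hom_{D⁻(C)}(M₁, M₂)` is a bijection. (Since the bounded above derived
category embeds fully faithfully in the unbounded one, this map is realized as the map induced by
the functor `ι₂.mapDerivedCategory` on morphisms between the corresponding objects of the
unbounded derived categories.) -/
theorem stmt4 {A B C : Type*} [Category A] [Category B] [Category C]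
    [Abelian A] [Abelian B] [Abelian C]
    (ι₁ : A ⥤ B) (ι₂ : B ⥤ C)
    [ι₁.Full] [ι₁.Faithful] [ι₁.Additive]
    [PreservesFiniteLimits ι₁] [PreservesFiniteColimits ι₁]
    [ι₂.Full] [ι₂.Faithful] [ι₂.Additive]
    [PreservesFiniteLimits ι₂] [PreservesFiniteColimits ι₂]
    -- `A` is a Serre subcategory of `C` (via the composite inclusion `ι₁ ⋙ ι₂`):
    (hsub : ∀ (X Z : C) (f : X ⟶ Z), Mono f →
      (∃ Y : A, Nonempty (Z ≅ (ι₁ ⋙ ι₂).obj Y)) → ∃ Y : A, Nonempty (X ≅ (ι₁ ⋙ ι₂).obj Y))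
    (hquot : ∀ (X Z : C) (f : X ⟶ Z), Epi f →
      (∃ Y : A, Nonempty (X ≅ (ι₁ ⋙ ι₂).obj Y)) → ∃ Y : A, Nonempty (Z ≅ (ι₁ ⋙ ι₂).obj Y))
    (hext : ∀ S : ShortComplex C, S.ShortExact →
      (∃ Y : A, Nonempty (S.X₁ ≅ (ι₁ ⋙ ι₂).obj Y)) →
      (∃ Y : A, Nonempty (S.X₃ ≅ (ι₁ ⋙ ι₂).obj Y)) →
      ∃ Y : A, Nonempty (S.X₂ ≅ (ι₁ ⋙ ι₂).obj Y))
    -- the key lifting hypothesis: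
    (hlift : ∀ (X : C) (Y : A) (f : X ⟶ (ι₁ ⋙ ι₂).obj Y), Epi f →
      ∃ (Y' : A) (g : (ι₁ ⋙ ι₂).obj Y' ⟶ X), Mono g ∧ Epi (g ≫ f))
    [HasDerivedCategory B] [HasDerivedCategory C]
    (K₁ : CochainComplex A ℤ) (K₂ : CochainComplex B ℤ)
    (hK₁ : ∃ n : ℤ, ∀ i, n < i → IsZero (K₁.X i))
    (hK₂ : ∃ n : ℤ, ∀ i, n < i → IsZero (K₂.X i)) :
    Function.Bijective
      (fun (f : DerivedCategory.Q.obj ((ι₁.mapHomologicalComplex (ComplexShape.up ℤ)).obj K₁) ⟶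
          DerivedCategory.Q.obj K₂) => ι₂.mapDerivedCategory.map f) := by
  have hlim : PreservesFiniteLimits (ι₁ ⋙ ι₂) := comp_preservesFiniteLimits _ _
  have hcolim : PreservesFiniteColimits (ι₁ ⋙ ι₂) := comp_preservesFiniteColimits _ _
  have resC := Stmt4Aux.res (ι₁ ⋙ ι₂) (fun X Z f hf => hsub X _ f hf ⟨Z, ⟨Iso.refl _⟩⟩)
    (fun X Z f hf => hquot _ Z f hf ⟨X, ⟨Iso.refl _⟩⟩) hlift K₁ hK₁
  let Φ := ι₂.mapHomologicalComplex (ComplexShape.up ℤ)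
  let Ψ := ι₁.mapHomologicalComplex (ComplexShape.up ℤ)
  have resC' : ∀ (L : CochainComplex C ℤ) (s : L ⟶ Φ.obj (Ψ.obj K₁)), QuasiIso s →
      ∃ (K' : CochainComplex A ℤ) (t : Φ.obj (Ψ.obj K') ⟶ L), QuasiIso t := resC
  constructor
  · intro f₁ f₂ h12
    rw [← sub_eq_zero]
    have hf : ι₂.mapDerivedCategory.map (f₁ - f₂) = 0 := by
      rw [Functor.map_sub, sub_eq_zero]
      exact h12
    generalize f₁ - f₂ = f at hf
    obtain ⟨L, s, hs, g, rfl⟩ := DerivedCategory.right_fac f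
    have hs' := (DerivedCategory.isIso_Q_map_iff_quasiIso _ s).1 hs
    have hg : ι₂.mapDerivedCategory.map (DerivedCategory.Q.map g) = 0 := by
      have := congr(ι₂.mapDerivedCategory.map (DerivedCategory.Q.map s) ≫ $hf)
      rw [← Functor.map_comp] at this
      simpa using this
    have hg2 : DerivedCategory.Q.map (Φ.map g) = 0 := by
      rw [Stmt4Aux.Q_map_map_eq] at hg
      have := congr(ι₂.mapDerivedCategoryFactors.inv.app L ≫ $hg ≫
        ι₂.mapDerivedCategoryFactors.hom.app K₂)
      simpa using this
    obtain ⟨L', t, ht, ⟨h⟩⟩ := Stmt4Aux.Q_map_eq_zero (Φ.map g) hg2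
    have hΦs : QuasiIso (Φ.map s) :=
      HomologicalComplex.quasiIso_map_of_preservesHomology s ι₂
    obtain ⟨K', t', ht'⟩ := resC' L' (t ≫ Φ.map s) inferInstance
    obtain ⟨u, hu⟩ := Stmt4Aux.exists_preimage ι₂ (t' ≫ t)
    have hu' : QuasiIso u := by
      rw [← HomologicalComplex.quasiIso_map_iff_of_preservesHomology u ι₂, hu]
      infer_instance
    have h2 : Homotopy (Φ.map (u ≫ g)) (Φ.map 0) :=
      ((Homotopy.ofEq (by
        rw [Functor.map_comp]
        erw [hu]
        rw [Category.assoc])).trans (h.compLeft t')).trans (Homotopy.ofEq (by simp))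
    have h3 := Stmt4Aux.Q_map_eq_zero_of_homotopy _ (ι₂.preimageHomotopy h2)
    rw [Functor.map_comp] at h3
    have h4 : DerivedCategory.Q.map g = 0 := by
      rw [← cancel_epi (DerivedCategory.Q.map u), h3, comp_zero]
    rw [h4, comp_zero]
  · intro f
    let e₁ := ι₂.mapDerivedCategoryFactors.app (Ψ.obj K₁)
    let e₂ := ι₂.mapDerivedCategoryFactors.app K₂
    obtain ⟨L, s, hs, g, hf⟩ := DerivedCategory.right_fac (X := Φ.obj (Ψ.obj K₁))
      (Y := Φ.obj K₂) (e₁.inv ≫ f ≫ e₂.hom)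
    have hs' := (DerivedCategory.isIso_Q_map_iff_quasiIso C s).1 hs
    obtain ⟨K', t, ht⟩ := resC' L s hs'
    obtain ⟨u, hu⟩ := Stmt4Aux.exists_preimage ι₂ (t ≫ s)
    obtain ⟨v, hv⟩ := Stmt4Aux.exists_preimage ι₂ (t ≫ g)
    have hu' : QuasiIso u := by
      rw [← HomologicalComplex.quasiIso_map_iff_of_preservesHomology u ι₂, hu]
      infer_instance
    refine ⟨inv (DerivedCategory.Q.map u) ≫ DerivedCategory.Q.map v, ?_⟩
    dsimp only
    rw [Functor.map_comp, Functor.map_inv, IsIso.inv_comp_eq, Stmt4Aux.Q_map_map_eq,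
      Stmt4Aux.Q_map_map_eq, hu, hv, Category.assoc, cancel_epi, Functor.map_comp,
      Functor.map_comp, Category.assoc, Category.assoc, Category.assoc, cancel_epi]
    have h5 : DerivedCategory.Q.map g = DerivedCategory.Q.map s ≫ e₁.inv ≫ f ≫ e₂.hom := by
      rw [hf, IsIso.hom_inv_id_assoc]
    rw [h5]
    change (_ ≫ e₁.inv ≫ f ≫ e₂.hom) ≫ e₂.inv = _ ≫ e₁.inv ≫ f
    simp
end

section
/- Let C be an abelian category with a full abelian subcategory B ⊆ C whose inclusion is exact, and assume that every object of B admits a monomorphism into an object of B which is injective as an object of C. Then for all M₁, M₂ in D⁺(B), the natural map Hom_{D⁺(B)}(M₁, M₂) → Hom_{D⁺(C)}(M₁, M₂) is a bijection, i.e., the functor D⁺(B) → D⁺(C) is fully faithful. -/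
open CategoryTheory CategoryTheory.Limits

/-- Bijectivity of a functor on hom-sets is invariant under isomorphisms. -/
lemma stmt14_map_bijective_of_iso {D E : Type*} [Category D] [Category E] (F : D ⥤ E)
    {X X' Y Y' : D} (e : X ≅ X') (e' : Y ≅ Y')
    (h : Function.Bijective (F.map : (X ⟶ Y) → _)) :
    Function.Bijective (F.map : (X' ⟶ Y') → _) := by
  constructor
  · intro f g hfg
    have : e.hom ≫ f ≫ e'.inv = e.hom ≫ g ≫ e'.inv := h.1 (by simp [hfg])
    simpa using this
  · intro g
    obtain ⟨f, hf⟩ := h.2 (F.map e.hom ≫ g ≫ F.map e'.inv)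
    refine ⟨e.inv ≫ f ≫ e'.hom, ?_⟩
    rw [F.map_comp, F.map_comp, hf]
    simp only [Category.assoc, Iso.map_inv_hom_id, Iso.map_inv_hom_id_assoc, Category.comp_id]

/-- Bijectivity of a functor on hom-sets is invariant under isomorphisms of functors. -/
lemma stmt14_map_bijective_of_natIso {D E : Type*} [Category D] [Category E] {F G : D ⥤ E}
    (e : F ≅ G) {X Y : D} (h : Function.Bijective (F.map : (X ⟶ Y) → _)) :
    Function.Bijective (G.map : (X ⟶ Y) → _) := by
  constructor
  · intro f g hfg
    apply h.1
    rw [← cancel_mono (e.hom.app Y)]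
    simp [hfg]
  · intro g
    obtain ⟨f, hf⟩ := h.2 (e.hom.app X ≫ g ≫ e.inv.app Y)
    refine ⟨f, ?_⟩
    rw [← cancel_epi (e.hom.app X), ← e.hom.naturality, hf]
    simp

theorem stmt14 {B C : Type*} [Category B] [Category C] [Abelian B] [Abelian C]
    (ι : B ⥤ C) [ι.Full] [ι.Faithful] [ι.Additive]
    [PreservesFiniteLimits ι] [PreservesFiniteColimits ι]
    (hinj : ∀ X : B, ∃ (I : B) (f : X ⟶ I), Mono f ∧ Injective (ι.obj I))
    [HasDerivedCategory B] [HasDerivedCategory C]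
    (K₁ K₂ : CochainComplex B ℤ)
    (hK₁ : ∃ n : ℤ, ∀ i, i < n → IsZero (K₁.X i))
    (hK₂ : ∃ n : ℤ, ∀ i, i < n → IsZero (K₂.X i)) :
    Function.Bijective
      (fun (f : DerivedCategory.Q.obj K₁ ⟶ DerivedCategory.Q.obj K₂) =>
        ι.mapDerivedCategory.map f) := by
  have hrefl : ∀ I : B, Injective (ι.obj I) → Injective I := fun I hI => ⟨fun {X Y} g f _ => by
    refine ⟨ι.preimage (Injective.factorThru (ι.map g) (ι.map f)), ι.map_injective ?_⟩
    simp⟩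
  have : EnoughInjectives B := ⟨fun X => by
    obtain ⟨I, f, hf, hI⟩ := hinj X
    exact ⟨⟨I, hrefl I hI, f, hf⟩⟩⟩
  have hpres : ∀ J : B, Injective J → Injective (ι.obj J) := fun J _ => by
    obtain ⟨I, f, hf, hI⟩ := hinj J
    refine ⟨fun {X Y} g i _ => ?_⟩
    refine ⟨Injective.factorThru (g ≫ ι.map f) i ≫ ι.map (Injective.factorThru (𝟙 J) f), ?_⟩
    rw [← Category.assoc, Injective.comp_factorThru, Category.assoc, ← ι.map_comp,
      Injective.comp_factorThru, ι.map_id, Category.comp_id]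
  obtain ⟨n, hn⟩ := hK₂
  have : K₂.IsStrictlyGE n := by
    rw [CochainComplex.isStrictlyGE_iff]
    exact hn
  obtain ⟨L, i, _, hL, _⟩ := CochainComplex.Plus.modelCategoryQuillen.exists_quasiIso_injective K₂ n
  have : L.IsKInjective := CochainComplex.isKInjective_of_injective L n
  let L' : CochainComplex C ℤ := (ι.mapHomologicalComplex _).obj L
  have : ∀ m, Injective (L'.X m) := fun m => hpres _ (hL m)
  have : L'.IsStrictlyGE n := by
    rw [CochainComplex.isStrictlyGE_iff]
    exact fun m hm => ι.map_isZero (L.isZero_of_isStrictlyGE n m hm)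
  have : L'.IsKInjective := CochainComplex.isKInjective_of_injective L' n
  let X := (HomotopyCategory.quotient B (.up ℤ)).obj K₁
  let Y := (HomotopyCategory.quotient B (.up ℤ)).obj L
  have h1 : Function.Bijective
      ((ι.mapHomotopyCategory (.up ℤ) ⋙ DerivedCategory.Qh).map : (X ⟶ Y) → _) :=
    (CochainComplex.IsKInjective.Qh_map_bijective
      ((ι.mapHomotopyCategory (.up ℤ)).obj X) L').comp
      ((Functor.FullyFaithful.ofFullyFaithful (ι.mapHomotopyCategory (.up ℤ))).map_bijective X Y)
  have h2 := stmt14_map_bijective_of_natIso ι.mapDerivedCategoryFactorsh.symm h1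
  have h3 : Function.Bijective
      (ι.mapDerivedCategory.map : (DerivedCategory.Qh.obj X ⟶ DerivedCategory.Qh.obj Y) → _) :=
    (Function.Bijective.of_comp_iff _
      (CochainComplex.IsKInjective.Qh_map_bijective X L)).1 h2
  exact stmt14_map_bijective_of_iso _ ((DerivedCategory.quotientCompQhIso B).app K₁)
    ((DerivedCategory.quotientCompQhIso B).app L ≪≫ (asIso (DerivedCategory.Q.map i)).symm) h3
end
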